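/- Radon–Nikodym type lemma for CP maps: If T and T′ are completely positive maps from a unital C*-algebra X into B(H) with T − T′ completely positive, and (π_T, K_T, V_T) is a minimal Stinespring representation of T, then there exists R in the commutant π_T(X)′ with 0 ≤ R ≤ 1 and T′(x) = V_T* R π_T(x) V_T for all x ∈ X. -/

import Mathlib

open scoped ComplexOrder InnerProductSpace

noncomputable section

/-- A matrix over a star ring is positive if it is of the form `Nᴴ * N`. -/
def MatPos {A : Type*} [Ring A] [StarRing A] {n : ℕ}
    (M : Matrix (Fin n) (Fin n) A) : Prop :=
  ∃ N : Matrix (Fin n) (Fin n) A, M = N.conjTranspose * N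

/-- `T` is completely positive if the induced entrywise maps on matrices are positive. -/
def CompletelyPositiveFun {A B : Type*} [Ring A] [StarRing A] [Ring B] [StarRing B]
    (T : A → B) : Prop :=
  ∀ (n : ℕ) (M : Matrix (Fin n) (Fin n) A), MatPos M → MatPos (M.map T)

/-- `(π, K, V)` is a Stinespring representation of `T : X → B(H)`:
`T x = V* (π x) V` for all `x`. -/
def IsStinespring {X : Type*} [NormedRing X] [StarRing X] [CStarRing X]
    [NormedAlgebra ℂ X] [StarModule ℂ X]
    {H K : Type*} [NormedAddCommGroup H] [InnerProductSpace ℂ H] [CompleteSpace H]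
    [NormedAddCommGroup K] [InnerProductSpace ℂ K] [CompleteSpace K]
    (T : X → (H →L[ℂ] H)) (π : X →⋆ₐ[ℂ] (K →L[ℂ] K)) (V : H →L[ℂ] K) : Prop :=
  ∀ x : X, T x = (ContinuousLinearMap.adjoint V).comp ((π x).comp V)

/-- Minimality: the closed linear span of `π(X) V H` is all of `K`. -/
def IsMinimalStinespring {X : Type*} [NormedRing X] [StarRing X] [CStarRing X]
    [NormedAlgebra ℂ X] [StarModule ℂ X]
    {H K : Type*} [NormedAddCommGroup H] [InnerProductSpace ℂ H] [CompleteSpace H]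
    [NormedAddCommGroup K] [InnerProductSpace ℂ K] [CompleteSpace K]
    (π : X →⋆ₐ[ℂ] (K →L[ℂ] K)) (V : H →L[ℂ] K) : Prop :=
  (Submodule.span ℂ {k : K | ∃ (x : X) (h : H), k = π x (V h)}).topologicalClosure = ⊤

/-- A positive semidefinite form dominated by `‖J ·‖ ^ 2` along a map `J` with dense range is
represented by a positive contraction. -/
theorem exists_isPositive_inner_eq_of_le {E K : Type*} [AddCommGroup E] [Module ℂ E]
    [NormedAddCommGroup K] [InnerProductSpace ℂ K] [CompleteSpace K]
    (c : PreInnerProductSpace.Core ℂ E) (J : E →ₗ[ℂ] K) (hJ : DenseRange J)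
    (hle : ∀ e, (c.inner e e).re ≤ ‖J e‖ ^ 2) :
    ∃ R : K →L[ℂ] K, R.IsPositive ∧ (1 - R).IsPositive ∧
      ∀ e f, ⟪J e, R (J f)⟫_ℂ = c.inner e f := by
  let _ : SeminormedAddCommGroup E := InnerProductSpace.Core.toSeminormedAddCommGroup (c := c)
  let _ : InnerProductSpace ℂ E := InnerProductSpace.ofCore c
  have hbound : ∀ e, ‖(UniformSpace.Completion.toComplL (𝕜 := ℂ) (E := E)).toLinearMap e‖
      ≤ 1 * ‖J e‖ := by
    intro e
    have h : ‖e‖ ^ 2 ≤ ‖J e‖ ^ 2 := by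
      rw [← inner_self_eq_norm_sq (𝕜 := ℂ) e]
      exact hle e
    simpa using (sq_le_sq₀ (norm_nonneg _) (norm_nonneg _)).mp h
  let W := LinearMap.extendOfNorm
    (UniformSpace.Completion.toComplL (𝕜 := ℂ) (E := E)).toLinearMap J
  have hW : ∀ e, W (J e) = (e : UniformSpace.Completion E) := fun e =>
    LinearMap.extendOfNorm_eq hJ ⟨1, hbound⟩ e
  have hW_le : ∀ k, ‖W k‖ ≤ ‖k‖ := fun k => by
    simpa using LinearMap.norm_extendOfNorm_apply_le hJ 1 hbound k
  have hpos := ContinuousLinearMap.isPositive_adjoint_comp_self W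
  refine ⟨ContinuousLinearMap.adjoint W ∘L W, hpos, ?_, fun e f => ?_⟩
  · refine ContinuousLinearMap.isPositive_def'.mpr
      ⟨(IsSelfAdjoint.one _).sub hpos.isSelfAdjoint, fun k => ?_⟩
    have h := pow_le_pow_left₀ (norm_nonneg _) (hW_le k) 2
    rw [← inner_self_eq_norm_sq (𝕜 := ℂ) k, ← inner_self_eq_norm_sq (𝕜 := ℂ) (W k)] at h
    simpa [ContinuousLinearMap.reApplyInnerSelf_apply, inner_sub_left,
      ContinuousLinearMap.adjoint_inner_left] using h
  · rw [ContinuousLinearMap.comp_apply, ContinuousLinearMap.adjoint_inner_right, hW, hW,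
      UniformSpace.Completion.inner_coe]

theorem matPos_star_mul {A : Type*} [Ring A] [StarRing A] {n : ℕ} (x : Fin n → A) :
    MatPos (Matrix.of fun i j => star (x i) * x j) := by
  rcases n with _ | n
  · exact ⟨0, Subsingleton.elim _ _⟩
  · refine ⟨Matrix.of fun i j => if i = 0 then x j else 0, ?_⟩
    ext i j
    simp [Matrix.mul_apply]

namespace CompletelyPositiveFun

variable {X : Type*} [Ring X] [StarRing X]

theorem star_map_star_mul {B : Type*} [Ring B] [StarRing B] {S : X → B}
    (hS : CompletelyPositiveFun S) (a b : X) : star (S (star a * b)) = S (star b * a) := by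
  obtain ⟨P, hP⟩ := hS 2 _ (matPos_star_mul ![a, b])
  have h01 := congr_fun₂ hP 0 1
  have h10 := congr_fun₂ hP 1 0
  simp [Matrix.mul_apply] at h01 h10
  simp [h01, h10]

variable {H : Type*} [NormedAddCommGroup H] [InnerProductSpace ℂ H] [CompleteSpace H]
  {S : X → (H →L[ℂ] H)}

theorem re_sum_inner_nonneg_fin (hS : CompletelyPositiveFun S) {n : ℕ} (x : Fin n → X)
    (h : Fin n → H) : 0 ≤ (∑ i, ∑ j, ⟪h i, S (star (x i) * x j) (h j)⟫_ℂ).re := by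
  obtain ⟨P, hP⟩ := hS n _ (matPos_star_mul x)
  have hP' : ∀ i j, S (star (x i) * x j) = ∑ k, star (P k i) * P k j := fun i j => by
    simpa [Matrix.mul_apply] using congr_fun₂ hP i j
  have hsum : ∑ i, ∑ j, ⟪h i, S (star (x i) * x j) (h j)⟫_ℂ
      = ∑ k, ⟪∑ i, P k i (h i), ∑ j, P k j (h j)⟫_ℂ := by
    simp only [hP', sum_apply, mul_apply_eq_comp,
      ContinuousLinearMap.star_eq_adjoint, inner_sum, sum_inner,
      ContinuousLinearMap.adjoint_inner_right]
    rw [Finset.sum_comm_cycle]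
    exact Finset.sum_congr rfl fun _ _ => Finset.sum_comm
  rw [hsum, Complex.re_sum]
  exact Finset.sum_nonneg fun k _ => inner_self_nonneg (𝕜 := ℂ)

theorem re_sum_inner_nonneg (hS : CompletelyPositiveFun S) (s : Finset X) (h : X → H) :
    0 ≤ (∑ x ∈ s, ∑ y ∈ s, ⟪h x, S (star x * y) (h y)⟫_ℂ).re := by
  have key := hS.re_sum_inner_nonneg_fin (fun i => (s.equivFin.symm i : X))
    (fun i => h (s.equivFin.symm i))
  rw [← s.equivFin.sum_comp] at key
  simp only [← s.equivFin.sum_comp (fun j => ⟪_, S (_ * (s.equivFin.symm j : X)) _⟫_ℂ),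
    Equiv.symm_apply_apply] at key
  rwa [← s.sum_coe_sort, Finset.sum_congr rfl fun x _ => (s.sum_coe_sort _).symm]

end CompletelyPositiveFun

/-- The sesquilinear form on `X →₀ H` induced by `S : X → B(H)`. -/
def finsuppForm {X : Type*} [Mul X] [Star X]
    {H : Type*} [NormedAddCommGroup H] [InnerProductSpace ℂ H]
    (S : X → (H →L[ℂ] H)) (e f : X →₀ H) : ℂ :=
  e.sum fun x h => f.sum fun y k => ⟪h, S (star x * y) k⟫_ℂ

/-- A completely positive map `S` induces a semi-inner product on `X →₀ H`. -/
@[reducible]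
def CompletelyPositiveFun.finsuppCore {X : Type*} [Ring X] [StarRing X]
    {H : Type*} [NormedAddCommGroup H] [InnerProductSpace ℂ H] [CompleteSpace H]
    {S : X → (H →L[ℂ] H)} (hS : CompletelyPositiveFun S) :
    PreInnerProductSpace.Core ℂ (X →₀ H) where
  inner := finsuppForm S
  conj_inner_symm e f := by
    simp only [finsuppForm, Finsupp.sum, map_sum, inner_conj_symm]
    rw [Finset.sum_comm]
    refine Finset.sum_congr rfl fun x _ => Finset.sum_congr rfl fun y _ => ?_
    rw [← hS.star_map_star_mul, ContinuousLinearMap.star_eq_adjoint,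
      ContinuousLinearMap.adjoint_inner_left]
  re_inner_nonneg e := hS.re_sum_inner_nonneg e.support e
  add_left e f g := by
    refine Finsupp.sum_add_index' (fun x => by simp) fun x h k => ?_
    simp [Finsupp.sum_add]
  smul_left e f r := by
    simp only [finsuppForm]
    rw [Finsupp.sum_smul_index' (fun x => by simp)]
    simp [Finsupp.sum, Finset.sum_mul, mul_comm]

/-- The linear map `X →₀ H → K` sending the point mass at `x` with value `h` to `π x (V h)`. -/
def stinespringMap {X : Type*} [NormedRing X] [StarRing X] [NormedAlgebra ℂ X]
    {H K : Type*} [NormedAddCommGroup H] [InnerProductSpace ℂ H]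
    [NormedAddCommGroup K] [InnerProductSpace ℂ K] [CompleteSpace K]
    (π : X →⋆ₐ[ℂ] (K →L[ℂ] K)) (V : H →L[ℂ] K) : (X →₀ H) →ₗ[ℂ] K :=
  Finsupp.lsum ℂ fun x => (π x ∘L V).toLinearMap

section Stinespring

variable {X : Type*} [NormedRing X] [StarRing X] [NormedAlgebra ℂ X]
  {H K : Type*} [NormedAddCommGroup H] [InnerProductSpace ℂ H]
  [NormedAddCommGroup K] [InnerProductSpace ℂ K] [CompleteSpace K]
  {π : X →⋆ₐ[ℂ] (K →L[ℂ] K)} {V : H →L[ℂ] K}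

theorem stinespringMap_single (x : X) (h : H) :
    stinespringMap π V (Finsupp.single x h) = π x (V h) := by
  simp [stinespringMap]

theorem inner_map_apply_left (x : X) (u v : K) : ⟪π x u, v⟫_ℂ = ⟪u, π (star x) v⟫_ℂ := by
  rw [map_star, ContinuousLinearMap.star_eq_adjoint, ContinuousLinearMap.adjoint_inner_right]

variable [CStarRing X] [StarModule ℂ X] [CompleteSpace H]

theorem IsMinimalStinespring.dense_span (hmin : IsMinimalStinespring π V) :
    Dense (Submodule.span ℂ {k : K | ∃ (x : X) (h : H), k = π x (V h)} : Set K) :=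
  Submodule.dense_iff_topologicalClosure_eq_top.mpr hmin

theorem IsMinimalStinespring.denseRange (hmin : IsMinimalStinespring π V) :
    DenseRange (stinespringMap π V) := by
  refine hmin.dense_span.mono ?_
  rw [← LinearMap.coe_range, SetLike.coe_subset_coe, Submodule.span_le]
  rintro _ ⟨x, h, rfl⟩
  exact ⟨Finsupp.single x h, stinespringMap_single x h⟩

theorem IsMinimalStinespring.ext_inner (hmin : IsMinimalStinespring π V) {A B : K →L[ℂ] K}
    (hAB : ∀ x h y k, ⟪π x (V h), A (π y (V k))⟫_ℂ = ⟪π x (V h), B (π y (V k))⟫_ℂ) : A = B := by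
  refine ContinuousLinearMap.ext_on hmin.dense_span ?_
  rintro _ ⟨y, k, rfl⟩
  refine ext_inner_left ℂ fun v => ?_
  have h : (innerSL ℂ (A (π y (V k)))) = innerSL ℂ (B (π y (V k))) := by
    refine ContinuousLinearMap.ext_on hmin.dense_span ?_
    rintro _ ⟨x, h, rfl⟩
    simp only [innerSL_apply_apply]
    rw [← inner_conj_symm, hAB, inner_conj_symm]
  rw [← inner_conj_symm, ← innerSL_apply_apply, h, innerSL_apply_apply, inner_conj_symm]

theorem IsStinespring.finsuppForm_eq {T : X → (H →L[ℂ] H)} (hst : IsStinespring T π V)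
    (e f : X →₀ H) :
    finsuppForm T e f = ⟪stinespringMap π V e, stinespringMap π V f⟫_ℂ := by
  simp only [finsuppForm, stinespringMap, Finsupp.lsum_apply, Finsupp.sum, sum_inner, inner_sum]
  rw [Finset.sum_comm (s := f.support)]
  refine Finset.sum_congr rfl fun x _ => Finset.sum_congr rfl fun y _ => ?_
  simp [hst _, ContinuousLinearMap.adjoint_inner_right, inner_map_apply_left]

end Stinespring

/-- Radon–Nikodym type lemma for CP maps (Arveson): if `T' ≤ T` are CP maps into `B(H)`
and `(π, K, V)` is a minimal Stinespring representation of `T`, then there is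
`R ∈ π(X)′` with `0 ≤ R ≤ 1` and `T' x = V* R π(x) V` for all `x`. -/
theorem cp_radon_nikodym
    {X : Type*} [NormedRing X] [StarRing X] [CStarRing X]
    [NormedAlgebra ℂ X] [StarModule ℂ X]
    {H K : Type*} [NormedAddCommGroup H] [InnerProductSpace ℂ H] [CompleteSpace H]
    [NormedAddCommGroup K] [InnerProductSpace ℂ K] [CompleteSpace K]
    (T T' : X →ₗ[ℂ] (H →L[ℂ] H))
    (hT : CompletelyPositiveFun (⇑T)) (hT' : CompletelyPositiveFun (⇑T'))
    (hle : CompletelyPositiveFun (fun x => T x - T' x))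
    (π : X →⋆ₐ[ℂ] (K →L[ℂ] K)) (V : H →L[ℂ] K)
    (hst : IsStinespring (⇑T) π V) (hmin : IsMinimalStinespring π V) :
    ∃ R : K →L[ℂ] K,
      (∀ x : X, R * π x = π x * R) ∧
      R.IsPositive ∧ (1 - R).IsPositive ∧
      ∀ x : X, T' x =
        (ContinuousLinearMap.adjoint V).comp ((R.comp ((π x).comp V))) := by
  have hbound : ∀ e, (finsuppForm T' e e).re ≤ ‖stinespringMap π V e‖ ^ 2 := by
    intro e
    have h := hle.re_sum_inner_nonneg e.support e
    simp only [sub_apply, inner_sub_right, Finset.sum_sub_distrib,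
      Complex.sub_re] at h
    rw [← inner_self_eq_norm_sq (𝕜 := ℂ), ← hst.finsuppForm_eq]
    exact sub_nonneg.mp h
  obtain ⟨R, hR, hR', hform⟩ :=
    exists_isPositive_inner_eq_of_le hT'.finsuppCore (stinespringMap π V) hmin.denseRange hbound
  have hRT : ∀ x h y k, ⟪π x (V h), R (π y (V k))⟫_ℂ = ⟪h, T' (star x * y) k⟫_ℂ := by
    intro x h y k
    rw [← stinespringMap_single, ← stinespringMap_single, hform]
    change finsuppForm T' _ _ = _
    simp [finsuppForm]
  have hcomm : ∀ x, R * π x = π x * R := by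
    refine fun a => hmin.ext_inner fun x h y k => ?_
    have h₁ := hRT x h (a * y) k
    have h₂ := hRT (star a * x) h y k
    rw [map_mul, mul_apply_eq_comp] at h₁ h₂
    rw [mul_apply_eq_comp, mul_apply_eq_comp, h₁,
      ← star_star a, ← inner_map_apply_left, h₂]
    simp [mul_assoc]
  refine ⟨R, hcomm, hR, hR', fun x => ?_⟩
  ext k
  refine ext_inner_left ℂ fun h => ?_
  have := hRT 1 h x k
  simpa [ContinuousLinearMap.adjoint_inner_right] using this.symm
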